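/- Let d be a positive integer and let β, μ, α be reals with 0 < α < μ < β < 1 and d > (H(μ) + β·H(μ/β)) / (μ·log₂(β/μ)). Then the sum ∑_{r=⌊αn⌋+1}^{⌊μn⌋} C(n,r)·C(m,r)·C(r,d)^r / C(m,d)^r, with m = ⌈βn⌉, decays exponentially in n: there exist constants C > 0, c > 0 and N such that for all n ≥ N this sum is at most C·2^{−cn}. -/

import Mathlib

/-- Binary entropy function (base 2). -/
noncomputable def binH (x : ℝ) : ℝ :=
  -x * Real.logb 2 x - (1 - x) * Real.logb 2 (1 - x)


lemma aux_choose (m r : ℕ) (hr : r ≤ m) (p : ℝ) (h0 : 0 < p) (h1 : p < 1) :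
    (m.choose r : ℝ) ≤ Real.exp (-(r * Real.log p) - ((m:ℝ) - r) * Real.log (1 - p)) := by
  have hq : 0 < 1 - p := by linarith
  have h : p ^ r * (1 - p) ^ (m - r) * (m.choose r : ℝ) ≤ 1 := by
    have e : (p + (1 - p)) ^ m = 1 := by simp
    refine le_trans ?_ e.le
    rw [add_pow]
    exact Finset.single_le_sum (f := fun k => p ^ k * (1 - p) ^ (m - k) * (m.choose k : ℝ))
      (fun i _ => by positivity) (Finset.mem_range.2 (Nat.lt_succ_of_le hr))
  have e2 : Real.exp (-(r * Real.log p) - ((m:ℝ) - r) * Real.log (1 - p))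
      = (p ^ r * (1 - p) ^ (m - r))⁻¹ := by
    rw [← Nat.cast_sub hr]
    rw [← Real.exp_log (show 0 < (p ^ r * (1 - p) ^ (m - r))⁻¹ by positivity)]
    congr 1
    rw [Real.log_inv, Real.log_mul (by positivity) (by positivity), Real.log_pow, Real.log_pow]
    ring
  rw [e2, le_inv_comm₀ ?_ (by positivity)]
  · rw [← one_div, le_div_iff₀ ?_]
    · exact h
    · exact_mod_cast Nat.choose_pos hr
  · exact_mod_cast Nat.choose_pos hr

lemma aux_desc (r m : ℕ) (hr : r ≤ m) (d : ℕ) :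
    r.descFactorial d * m ^ d ≤ m.descFactorial d * r ^ d := by
  induction d with
  | zero => simp
  | succ d ih =>
    rw [Nat.descFactorial_succ, Nat.descFactorial_succ, pow_succ, pow_succ]
    have : (r - d) * m ≤ (m - d) * r := by
      rw [Nat.sub_mul, Nat.sub_mul, mul_comm m r]
      exact Nat.sub_le_sub_left (Nat.mul_le_mul_left d hr) _
    calc (r - d) * r.descFactorial d * (m ^ d * m)
        = (r.descFactorial d * m ^ d) * ((r - d) * m) := by ring
      _ ≤ (m.descFactorial d * r ^ d) * ((m - d) * r) := Nat.mul_le_mul ih this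
      _ = _ := by ring

lemma aux_ratio (r m : ℕ) (hr : r ≤ m) (hm : 0 < m) (d : ℕ) :
    (r.choose d : ℝ) / (m.choose d : ℝ) ≤ ((r : ℝ) / m) ^ d := by
  have h := aux_desc r m hr d
  rw [Nat.descFactorial_eq_factorial_mul_choose, Nat.descFactorial_eq_factorial_mul_choose,
    mul_assoc, mul_assoc] at h
  have h2 := Nat.le_of_mul_le_mul_left h (Nat.factorial_pos d)
  rcases Nat.eq_zero_or_pos (m.choose d) with h0 | h0
  · rw [h0]; simp; positivity
  · have h0' : (0:ℝ) < m.choose d := by exact_mod_cast h0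
    have hm' : (0:ℝ) < m := by exact_mod_cast hm
    rw [div_pow, div_le_div_iff₀ h0' (by positivity)]
    rw [mul_comm ((r:ℝ)^d)]
    exact_mod_cast h2

noncomputable def aphi (x : ℝ) : ℝ := -((1 - x) * Real.log (1 - x)) / x

lemma aux_slope {x y : ℝ} (hx : 0 < x) (hxy : x ≤ y) (hy : y < 1) :
    Real.log (1 - y) / y ≤ Real.log (1 - x) / x := by
  have hy0 : 0 < y := by linarith
  rw [div_le_div_iff₀ hy0 hx]
  have hcc : ConcaveOn ℝ (Set.Ioi 0) Real.log := strictConcaveOn_log_Ioi.concaveOn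
  have hc := hcc.2 (x := 1 - y) (y := 1)
    (by simp only [Set.mem_Ioi]; linarith) (by simp) (show 0 ≤ x / y by positivity)
    (show 0 ≤ 1 - x / y by rw [sub_nonneg, div_le_one hy0]; exact hxy) (by ring)
  simp only [smul_eq_mul, Real.log_one, mul_zero, add_zero, mul_one] at hc
  have e : x / y * (1 - y) + (1 - x / y) = 1 - x := by field_simp; ring
  rw [e] at hc
  have := mul_le_mul_of_nonneg_right hc hy0.le
  calc _ = x / y * Real.log (1 - y) * y := by field_simp
    _ ≤ _ := this

lemma aux_concave : ConcaveOn ℝ (Set.Iic 0) (fun s : ℝ => aphi (Real.exp s)) := by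
  have hder : ∀ s < 0, HasDerivAt (fun s : ℝ => aphi (Real.exp s))
      (1 + Real.log (1 - Real.exp s) / Real.exp s) s := by
    intro s hs
    have h1 : 0 < 1 - Real.exp s := by
      have := (by rwa [← Real.exp_zero, Real.exp_lt_exp] : Real.exp s < 1); linarith
    have hE := Real.hasDerivAt_exp s
    have hA := hE.const_sub 1
    have hL := hA.log h1.ne'
    have := ((hA.mul hL).neg).div hE (Real.exp_pos s).ne'
    refine this.congr_deriv ?_
    have := (Real.exp_pos s).ne'
    have := h1.ne'
    simp only [Pi.neg_apply, Pi.mul_apply]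
    field_simp
    ring
  refine AntitoneOn.concaveOn_of_deriv (convex_Iic 0) ?_ ?_ ?_
  · apply Continuous.continuousOn
    unfold aphi
    refine Continuous.div ?_ Real.continuous_exp (fun s => (Real.exp_pos s).ne')
    exact (Real.continuous_mul_log.comp (by fun_prop : Continuous fun s => 1 - Real.exp s)).neg
  · rw [interior_Iic]
    intro s hs
    exact (hder s hs).differentiableAt.differentiableWithinAt
  · rw [interior_Iic]
    intro s hs t ht hst
    rw [(hder s hs).deriv, (hder t ht).deriv]
    have := aux_slope (Real.exp_pos s) (Real.exp_le_exp.2 hst) (by rw [← Real.exp_zero, Real.exp_lt_exp]; exact ht)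
    linarith

noncomputable def ah (β : ℝ) (d : ℕ) (x : ℝ) : ℝ :=
  -Real.log x + aphi x + aphi (x / β) + ((d:ℝ) - 1) * Real.log (x / β)

lemma aux_mono (β μ x : ℝ) (d : ℕ) (hx : 0 < x) (hxμ : x ≤ μ) (hμβ : μ < β) (hβ1 : β < 1)
    (hneg : ah β d μ < 0) : ah β d x ≤ ah β d μ := by
  have hμ : 0 < μ := by linarith
  have hβ : 0 < β := by linarith
  by_contra! hlt
  have hb : 0 ≤ ah β d β := by
    unfold ah aphi
    rw [div_self hβ.ne']
    simp only [sub_self, Real.log_one, mul_zero, neg_zero, zero_div, add_zero, zero_mul]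
    have h1 := Real.log_neg hβ hβ1
    have h2 := Real.log_neg (show 0 < 1 - β by linarith) (by linarith)
    have : 0 ≤ -((1 - β) * Real.log (1 - β)) / β := by
      apply div_nonneg _ hβ.le
      nlinarith
    linarith
  have hlb := Real.log_neg hβ hβ1
  -- convex combination
  have hxl : x < μ := lt_of_le_of_ne hxμ (by rintro rfl; exact lt_irrefl _ hlt)
  have l1 := Real.log_lt_log hx hxl
  have l2 := Real.log_lt_log hμ hμβ
  obtain ⟨a, b, ha, hb', hab, hcomb⟩ : ∃ a b : ℝ, 0 < a ∧ 0 < b ∧ a + b = 1 ∧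
      a * Real.log x + b * Real.log β = Real.log μ := by
    have hD : 0 < Real.log β - Real.log x := by linarith
    refine ⟨(Real.log β - Real.log μ) / (Real.log β - Real.log x),
      (Real.log μ - Real.log x) / (Real.log β - Real.log x),
      div_pos (by linarith) hD, div_pos (by linarith) hD, ?_, ?_⟩
    · field_simp; ring
    · field_simp; ring
  have c1 := aux_concave.2 (x := Real.log x) (y := Real.log β)
    (by simp only [Set.mem_Iic]; linarith) (by simp only [Set.mem_Iic]; linarith)
    ha.le hb'.le hab
  have c2 := aux_concave.2 (x := Real.log x - Real.log β) (y := Real.log β - Real.log β)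
    (by simp only [Set.mem_Iic]; linarith) (by simp)
    ha.le hb'.le hab
  simp only [smul_eq_mul] at c1 c2
  have e2 : a * (Real.log x - Real.log β) + b * (Real.log β - Real.log β)
      = Real.log μ - Real.log β := by
    have : b = 1 - a := by linarith
    subst this; rw [← hcomb]; ring
  rw [e2] at c2
  rw [hcomb] at c1
  simp only [Real.exp_sub, Real.exp_log hx, Real.exp_log hβ, Real.exp_log hμ] at c1 c2
  have key : a * ah β d x + b * ah β d β ≤ ah β d μ := by
    unfold ah
    rw [Real.log_div hx.ne' hβ.ne', Real.log_div hμ.ne' hβ.ne', Real.log_div hβ.ne' hβ.ne',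
      ← e2, ← hcomb]
    linarith
  nlinarith [mul_nonneg hb'.le hb, mul_lt_mul_of_pos_left hlt ha]

lemma aux_term (β μ : ℝ) (d n r : ℕ) (hβ1 : β < 1) (hμβ : μ < β) (hr : 0 < r)
    (hrn : (r:ℝ) ≤ μ * n) :
    ((n.choose r : ℝ) * ((⌈β * (n : ℝ)⌉₊).choose r : ℝ) *
          ((r.choose d : ℝ)) ^ r) / (((⌈β * (n : ℝ)⌉₊).choose d : ℝ)) ^ r
      ≤ Real.exp (-Real.log (1 - μ / β)) * Real.exp (r * ah β d (r / n)) := by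
  have hr' : (0:ℝ) < r := by exact_mod_cast hr
  have hn : (0:ℝ) < n := by
    rcases (Nat.cast_nonneg (α := ℝ) n).eq_or_lt with h | h
    · rw [← h] at hrn; linarith
    · exact h
  have hμ : 0 < μ := by
    by_contra! h
    nlinarith
  have hβ : 0 < β := by linarith
  set m := ⌈β * (n:ℝ)⌉₊ with hm
  have hm1 : β * n ≤ m := Nat.le_ceil _
  have hm2 : (m:ℝ) < β * n + 1 := Nat.ceil_lt_add_one (by positivity)
  have hrβ : (r:ℝ) < β * n := lt_of_le_of_lt hrn (by nlinarith)
  have hrm : r ≤ m := by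
    have : (r:ℝ) ≤ m := by linarith
    exact_mod_cast this
  have hrn' : r ≤ n := by
    have : (r:ℝ) ≤ n := by nlinarith
    exact_mod_cast this
  have hx0 : 0 < (r:ℝ) / n := by positivity
  have hxμ : (r:ℝ) / n ≤ μ := by rw [div_le_iff₀ hn]; exact hrn
  set x := (r:ℝ) / n with hx
  have hy0 : 0 < x / β := by positivity
  have hyμ : x / β ≤ μ / β := by gcongr
  have hμβ1 : μ / β < 1 := by rw [div_lt_one hβ]; exact hμβ
  have hrx : (r:ℝ) = x * n := by rw [hx]; field_simp
  have A := aux_choose n r hrn' x hx0 (by linarith)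
  have B := aux_choose m r hrm (x / β) hy0 (by linarith)
  have Cc : ((r.choose d : ℝ) / (m.choose d : ℝ)) ^ r
      ≤ Real.exp (r * (d * Real.log (x / β))) := by
    have hm0 : 0 < m := by omega
    have h1 := aux_ratio r m hrm hm0 d
    have h2 : (r:ℝ) / m ≤ x / β := by
      rw [hx, div_div, mul_comm (n:ℝ)]
      gcongr
    have h3 : (r.choose d : ℝ) / (m.choose d : ℝ) ≤ (x / β) ^ d :=
      h1.trans (by gcongr)
    calc _ ≤ ((x / β) ^ d) ^ r := by gcongr
      _ = _ := by
        rw [Real.exp_nat_mul, Real.exp_nat_mul, Real.exp_log hy0]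
  rw [mul_div_assoc, ← div_pow]
  refine (mul_le_mul (mul_le_mul A B (by positivity) (by positivity)) Cc (by positivity)
    (by positivity)).trans ?_
  rw [← Real.exp_add, ← Real.exp_add, ← Real.exp_add, Real.exp_le_exp]
  have l1 : Real.log (1 - x / β) ≤ 0 := Real.log_nonpos (by linarith) (by linarith)
  have l2 : Real.log (1 - μ / β) ≤ Real.log (1 - x / β) :=
    Real.log_le_log (by linarith) (by linarith)
  have E1 : (r:ℝ) * aphi x = -(((n:ℝ) - r) * Real.log (1 - x)) := by
    unfold aphi; rw [hrx]; field_simp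
  have E2 : (r:ℝ) * aphi (x / β) = -((β * n - r) * Real.log (1 - x / β)) := by
    unfold aphi; rw [hrx]; field_simp
  have E3 : -(((m:ℝ) - r) * Real.log (1 - x / β)) ≤
      -((β * n - r) * Real.log (1 - x / β)) - Real.log (1 - x / β) := by
    nlinarith
  unfold ah
  have : (r:ℝ) * (-Real.log x + aphi x + aphi (x / β) + ((d:ℝ) - 1) * Real.log (x / β))
    = -(r * Real.log x) + r * aphi x + r * aphi (x / β) + r * (d * Real.log (x / β))
      - r * Real.log (x / β) := by ring
  rw [this, E1, E2]
  linarith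

lemma aux_neg (d : ℕ) (β μ : ℝ) (hμ : 0 < μ) (hμβ : μ < β)
    (hdd : (binH μ + β * binH (μ / β)) / (μ * Real.logb 2 (β / μ)) < (d : ℝ)) :
    ah β d μ < 0 := by
  have hβ : 0 < β := by linarith
  have hl : 0 < Real.log (β / μ) := Real.log_pos (by rw [lt_div_iff₀ hμ]; linarith)
  have l2 : 0 < Real.log 2 := Real.log_pos (by norm_num)
  have hlb : 0 < Real.logb 2 (β / μ) := div_pos hl l2
  rw [div_lt_iff₀ (by positivity)] at hdd
  have h := mul_lt_mul_of_pos_right hdd l2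
  have e1 : (binH μ + β * binH (μ / β)) * Real.log 2 =
      μ * (-Real.log μ + aphi μ - Real.log (μ / β) + aphi (μ / β)) := by
    unfold binH aphi Real.logb; field_simp; ring
  have e2 : (d:ℝ) * (μ * Real.logb 2 (β / μ)) * Real.log 2 =
      μ * (-(d * Real.log (μ / β))) := by
    rw [← inv_div β μ, Real.log_inv]
    unfold Real.logb; field_simp; try ring
  rw [e1, e2] at h
  have h := lt_of_mul_lt_mul_left h hμ.le
  unfold ah
  linarith

/-- for a positive integer d and 0 < α < μ < β < 1 with
d > (H(μ) + β H(μ/β)) / (μ log₂(β/μ)), the linear part of the union bound,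
∑_{r=⌊αn⌋+1}^{⌊μn⌋} C(n,r) C(m,r) C(r,d)^r / C(m,d)^r with m = ⌈βn⌉, decays
exponentially in n. -/
theorem stmt_14 (d : ℕ) (hd : 0 < d) (β μ α : ℝ)
    (hα0 : 0 < α) (hαμ : α < μ) (hμβ : μ < β) (hβ1 : β < 1)
    (hdd : (binH μ + β * binH (μ / β)) / (μ * Real.logb 2 (β / μ)) < (d : ℝ)) :
    ∃ C c : ℝ, 0 < C ∧ 0 < c ∧ ∃ N : ℕ, ∀ n : ℕ, N ≤ n →
      ∑ r ∈ Finset.Icc (⌊α * (n : ℝ)⌋₊ + 1) ⌊μ * (n : ℝ)⌋₊,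
        ((n.choose r : ℝ) * ((⌈β * (n : ℝ)⌉₊).choose r : ℝ) *
          ((r.choose d : ℝ)) ^ r) / (((⌈β * (n : ℝ)⌉₊).choose d : ℝ)) ^ r
      ≤ C * (2 : ℝ) ^ (-(c * (n : ℝ))) := by
  have hμ : 0 < μ := by linarith
  have hneg := aux_neg d β μ hμ hμβ hdd
  set K := Real.exp (-Real.log (1 - μ / β)) with hK
  have hK0 : 0 < K := Real.exp_pos _
  obtain ⟨c, hc0, hc⟩ : ∃ c : ℝ, 0 < c ∧ α * ah β d μ = -(2 * c) :=
    ⟨-(α * ah β d μ) / 2, by nlinarith, by ring⟩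
  have l2 : 0 < Real.log 2 := Real.log_pos (by norm_num)
  refine ⟨K / c, c / Real.log 2, by positivity, by positivity, 1, fun n hn => ?_⟩
  have hn0 : (0:ℝ) < n := by exact_mod_cast hn
  have e : (2:ℝ) ^ (-(c / Real.log 2 * (n:ℝ))) = Real.exp (-(c * n)) := by
    rw [Real.rpow_def_of_pos (by norm_num)]
    congr 1; field_simp
  rw [e]
  refine (Finset.sum_le_card_nsmul _ _ (K * Real.exp (-(2 * c) * n)) ?_).trans ?_
  · intro r hr
    rw [Finset.mem_Icc] at hr
    have h1 : α * n < r := (Nat.floor_lt (by positivity)).1 (by omega)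
    have h2 : (r:ℝ) ≤ μ * n := (Nat.le_floor_iff (by positivity)).1 hr.2
    have hr0 : 0 < r := by omega
    refine (aux_term β μ d n r hβ1 hμβ hr0 h2).trans ?_
    have hr' : (0:ℝ) < r := by exact_mod_cast hr0
    have hm := aux_mono β μ (r / n) d (by positivity) (by rw [div_le_iff₀ hn0]; exact h2)
      hμβ hβ1 hneg
    refine mul_le_mul_of_nonneg_left (Real.exp_le_exp.2 ?_) hK0.le
    rw [← hc]
    nlinarith
  · have hcard : ((Finset.Icc (⌊α * (n : ℝ)⌋₊ + 1) ⌊μ * (n : ℝ)⌋₊).card : ℝ) ≤ n := by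
      have h3 : (⌊μ * (n:ℝ)⌋₊ : ℝ) ≤ n :=
        (Nat.floor_le (by positivity)).trans (by nlinarith)
      have h4 : ⌊μ * (n:ℝ)⌋₊ ≤ n := by exact_mod_cast h3
      rw [Nat.card_Icc]
      have : ⌊μ * (n:ℝ)⌋₊ + 1 - (⌊α * (n : ℝ)⌋₊ + 1) ≤ n := by omega
      exact_mod_cast this
    rw [nsmul_eq_mul]
    have h5 : c * n ≤ Real.exp (c * n) := by linarith [Real.add_one_le_exp (c * (n:ℝ))]
    have h6 : Real.exp (-(2 * c) * n) * Real.exp (c * n) = Real.exp (-(c * n)) := by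
      rw [← Real.exp_add]; congr 1; ring
    calc _ ≤ (n:ℝ) * (K * Real.exp (-(2 * c) * n)) := by gcongr
      _ = K / c * (Real.exp (-(2 * c) * n) * (c * n)) := by field_simp
      _ ≤ K / c * (Real.exp (-(2 * c) * n) * Real.exp (c * n)) := by gcongr
      _ = _ := by rw [h6]
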